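/- Let k be an integer with 2 ≤ k and 2k ≤ n, ε ∈ {1,−1}, and 1 ≤ i ≤ n−1. Then the P_i-orbit { p·X_{k,ε}·p⁻¹ : p ∈ P_i } is open and dense in O_{k,ε}, and it is the unique dense P_i-orbit contained in O_{k,ε}: if Z ∈ O_{k,ε} has dense P_i-orbit in O_{k,ε}, then Z = p·X_{k,ε}·p⁻¹ for some p ∈ P_i. -/

import Mathlib

open Matrix

/-- The n×n real matrix unit `E_{a,b}` (1-based indices). -/
noncomputable def Ematrix (n a b : ℕ) : Matrix (Fin n) (Fin n) ℝ :=
  fun s t => if (s : ℕ) + 1 = a ∧ (t : ℕ) + 1 = b then 1 else 0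

/-- `X_{k,ε} = Σ_{i=1}^{k−1} E_{n+1−i,i} + ε·E_{n+1−k,k}`. -/
noncomputable def Xmat (n k : ℕ) (ε : ℝ) : Matrix (Fin n) (Fin n) ℝ :=
  (∑ i ∈ Finset.Icc 1 (k - 1), Ematrix n (n + 1 - i) i) + ε • Ematrix n (n + 1 - k) k

/-- The spherical nilpotent orbit `O_{k,ε} = { g·X_{k,ε}·g⁻¹ : g ∈ SL_n(ℝ) }`. -/
def Orb (n k : ℕ) (ε : ℝ) : Set (Matrix (Fin n) (Fin n) ℝ) :=
  {M | ∃ g : Matrix.SpecialLinearGroup (Fin n) ℝ, g.val * Xmat n k ε * (g⁻¹).val = M}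

/-- Membership in the maximal parabolic subgroup `P_i ⊆ SL_n(ℝ)`:
the lower-left (n−i)×i block vanishes (1-based: entries (s,t) with s > i ≥ t are zero). -/
def memP (n i : ℕ) (p : Matrix.SpecialLinearGroup (Fin n) ℝ) : Prop :=
  ∀ s t : Fin n, i ≤ (s : ℕ) → (t : ℕ) < i → p.val s t = 0

/-- The `P_i`-orbit of `X_{k,ε}`. -/
def POrb (n i k : ℕ) (ε : ℝ) : Set (Matrix (Fin n) (Fin n) ℝ) :=
  {M | ∃ p : Matrix.SpecialLinearGroup (Fin n) ℝ, memP n i p ∧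
    p.val * Xmat n k ε * (p⁻¹).val = M}

theorem exists_conj_of_left_inverse {R : Type*} [Ring R] [IsDedekindFiniteMonoid R]
    {x y g g' V : R} (hxyx : x * y * x = x) (hyxy : y * x * y = y) (hxx : x * x = 0)
    (hyy : y * y = 0) (hg : g' * g = 1)
    (hV : V * (1 + y * (g * x * g' * y - 1) * x) = 1) :
    ∃ m q : R, q * (1 - x * y + g * x * g' * y - y * x * m * (1 - x * y - y * x)) = 1 ∧
      g * x * g' * (1 - x * y + g * x * g' * y - y * x * m * (1 - x * y - y * x)) =
        (1 - x * y + g * x * g' * y - y * x * m * (1 - x * y - y * x)) * x := by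
  obtain ⟨z, hz⟩ : ∃ z, z = g * x * g' := ⟨_, rfl⟩
  have hxyx' (r : R) : x * (y * (x * r)) = x * r := by rw [← mul_assoc, ← mul_assoc, hxyx]
  have hyxy' (r : R) : y * (x * (y * r)) = y * r := by rw [← mul_assoc, ← mul_assoc, hyxy]
  have hxx' (r : R) : x * (x * r) = 0 := by rw [← mul_assoc, hxx, zero_mul]
  have hyy' (r : R) : y * (y * r) = 0 := by rw [← mul_assoc, hyy, zero_mul]
  have hg' (r : R) : g' * (g * r) = r := by rw [← mul_assoc, hg, one_mul]
  rw [mul_assoc] at hxyx hyxy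
  have hzz (r : R) : z * (z * r) = 0 := by
    simp only [hz, mul_assoc, hg', hxx', mul_zero]
  have hVz : V * (y * (z * (y * x))) = y * x := by
    have h := congrArg (· * (y * x)) hV
    rw [← hz] at h
    simpa only [mul_add, add_mul, mul_sub, sub_mul, mul_one, one_mul, mul_assoc, hxyx, hxyx',
      add_sub_cancel] using h
  have hVz' (r : R) : V * (y * (z * (y * (x * r)))) = y * (x * r) := by
    simpa only [mul_assoc] using congrArg (· * r) hVz
  have hba : (y * x * g' * (y * x)) * (y * x * V * y * g * x) = y * x := by
    have hab : (y * x * V * y * g * x) * (y * x * g' * (y * x)) = y * x := by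
      have h := congrArg (fun r => y * x * r) hVz
      simpa only [hz, mul_assoc, hxyx, hxyx'] using h
    have h1 : (y * x * V * y * g * x + (1 - y * x)) * (y * x * g' * (y * x) + (1 - y * x)) = 1 := by
      have : (y * x * V * y * g * x + (1 - y * x)) * (y * x * g' * (y * x) + (1 - y * x)) =
          (y * x * V * y * g * x) * (y * x * g' * (y * x)) + (1 - y * x) := by
        simp only [mul_add, add_mul, mul_sub, sub_mul, mul_one, one_mul, mul_assoc, hxyx, hxyx']
        abel
      rw [this, hab, add_sub_cancel]
    have h2 : (y * x * g' * (y * x) + (1 - y * x)) * (y * x * V * y * g * x + (1 - y * x)) =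
        (y * x * g' * (y * x)) * (y * x * V * y * g * x) + (1 - y * x) := by
      simp only [mul_add, add_mul, mul_sub, sub_mul, mul_one, one_mul, mul_assoc, hxyx, hxyx']
      abel
    rw [mul_eq_one_comm.mp h1] at h2
    rw [eq_sub_of_add_eq h2.symm, sub_sub_cancel]
  have hzWz : z * (y * (x * (V * (y * z)))) = z := by
    have h := congrArg (fun r => g * x * r * g') hba
    simpa only [hz, mul_assoc, hxyx, hxyx'] using h
  have hzWz' (r : R) : z * (y * (x * (V * (y * (z * r))))) = z * r := by
    simpa only [mul_assoc] using congrArg (· * r) hzWz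
  have hVzy : V * (y * (z * y)) = y := by
    simpa only [hyxy] using hVz' y
  have hVzy' (r : R) : V * (y * (z * (y * r))) = y * r := by
    simpa only [mul_assoc] using congrArg (· * r) hVzy
  refine ⟨V * y * z, x * V * y + 1 - z * V * y + y * x * V * y * z *
    (1 - x * y - y * x - (1 - x * y - y * x) * z * V * y), ?_, ?_⟩
  · rw [← hz]
    simp only [mul_add, add_mul, mul_sub, sub_mul, mul_one, one_mul, mul_assoc, hxyx, hxyx',
      hyxy, hxx', hyy', hVz, hVz', hVzy, mul_zero]
    abel
  · rw [← hz]
    simp only [mul_add, add_mul, mul_sub, sub_mul, mul_one, one_mul, mul_assoc, hxyx,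
      hxx, hzz, hzWz, hzWz', mul_zero]
    abel

theorem Xmat_apply {n k : ℕ} (hk : 1 ≤ k) (hkn : k ≤ n) (ε : ℝ) (s t : Fin n) :
    Xmat n k ε s t =
      if (s : ℕ) + t + 1 = n ∧ (t : ℕ) < k then (if (t : ℕ) + 1 = k then ε else 1) else 0 := by
  have hs := s.isLt
  have ht := t.isLt
  have hsum : (∑ i ∈ Finset.Icc 1 (k - 1), Ematrix n (n + 1 - i) i) s t =
      if (s : ℕ) + t + 1 = n ∧ (t : ℕ) + 1 < k then 1 else 0 := by
    rw [Matrix.sum_apply]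
    simp only [Ematrix]
    split_ifs with h
    · rw [Finset.sum_eq_single ((t : ℕ) + 1)]
      · rw [if_pos (by omega)]
      · intro b _ hb
        rw [if_neg (by omega)]
      · intro hb
        exact absurd (Finset.mem_Icc.mpr (by omega)) hb
    · refine Finset.sum_eq_zero fun b hb => ?_
      rw [Finset.mem_Icc] at hb
      rw [if_neg (by omega)]
  simp only [Xmat, Matrix.add_apply, hsum, Matrix.smul_apply, Ematrix, smul_eq_mul]
  split_ifs <;> first | omega | simp

theorem Xmat_apply_of_add_ne {n k : ℕ} (hk : 1 ≤ k) (hkn : k ≤ n) (ε : ℝ) {s t : Fin n}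
    (h : (s : ℕ) + t + 1 ≠ n) : Xmat n k ε s t = 0 := by
  rw [Xmat_apply hk hkn, if_neg (by omega)]

theorem Xmat_apply_of_le {n k : ℕ} (hk : 1 ≤ k) (hkn : k ≤ n) (ε : ℝ) {s t : Fin n}
    (h : k ≤ (t : ℕ)) : Xmat n k ε s t = 0 := by
  rw [Xmat_apply hk hkn, if_neg (by omega)]

theorem Xmat_apply_of_row_lt {n k : ℕ} (hk : 1 ≤ k) (hkn : k ≤ n) (ε : ℝ) {s t : Fin n}
    (h : (s : ℕ) < n - k) : Xmat n k ε s t = 0 := by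
  rw [Xmat_apply hk hkn, if_neg (by omega)]

theorem transpose_Xmat_mul_Xmat {n k : ℕ} (hk : 1 ≤ k) (hkn : k ≤ n) {ε : ℝ}
    (hε : ε = 1 ∨ ε = -1) :
    (Xmat n k ε)ᵀ * Xmat n k ε =
      Matrix.diagonal fun s : Fin n => if (s : ℕ) < k then (1 : ℝ) else 0 := by
  ext s t
  have hs := s.isLt
  have ht := t.isLt
  rw [Matrix.mul_apply, Finset.sum_eq_single s.rev]
  · simp only [Matrix.transpose_apply, Xmat_apply hk hkn, Matrix.diagonal_apply, Fin.ext_iff,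
      Fin.val_rev]
    rcases hε with rfl | rfl <;> split_ifs <;> first | omega | simp
  · intro b _ hb
    rw [Ne, Fin.ext_iff, Fin.val_rev] at hb
    rw [Matrix.transpose_apply, Xmat_apply_of_add_ne hk hkn ε (by omega), zero_mul]
  · simp

theorem transpose_submatrix_rev_Xmat {n k : ℕ} (hk : 1 ≤ k) (hkn : k ≤ n) (ε : ℝ) :
    (Xmat n k ε)ᵀ.submatrix Fin.revPerm Fin.revPerm = Xmat n k ε := by
  ext s t
  have hs := s.isLt
  have ht := t.isLt
  simp only [Matrix.submatrix_apply, Matrix.transpose_apply, Xmat_apply hk hkn,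
    Fin.revPerm_apply, Fin.val_rev]
  split_ifs <;> first | omega | rfl

theorem transpose_mul_submatrix_rev {n : ℕ} (A B : Matrix (Fin n) (Fin n) ℝ) :
    (A * B)ᵀ.submatrix Fin.revPerm Fin.revPerm =
      Bᵀ.submatrix Fin.revPerm Fin.revPerm * Aᵀ.submatrix Fin.revPerm Fin.revPerm := by
  rw [Matrix.transpose_mul, Matrix.submatrix_mul_equiv]

theorem Xmat_mul_transpose_Xmat {n k : ℕ} (hk : 1 ≤ k) (hkn : k ≤ n) {ε : ℝ}
    (hε : ε = 1 ∨ ε = -1) :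
    Xmat n k ε * (Xmat n k ε)ᵀ =
      Matrix.diagonal fun s : Fin n => if n - k ≤ (s : ℕ) then (1 : ℝ) else 0 := by
  have h := congrArg (fun A : Matrix (Fin n) (Fin n) ℝ => Aᵀ.submatrix Fin.revPerm Fin.revPerm)
    (transpose_Xmat_mul_Xmat hk hkn hε)
  have hX := congrArg Matrix.transpose (transpose_submatrix_rev_Xmat hk hkn ε)
  simp only [transpose_mul_submatrix_rev, transpose_submatrix_rev_Xmat hk hkn] at h
  rw [Matrix.transpose_submatrix] at hX
  rw [hX] at h
  rw [h, Matrix.diagonal_transpose, Matrix.submatrix_diagonal_equiv]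
  congr 1
  ext s
  have hs := s.isLt
  simp only [Function.comp_apply, Fin.revPerm_apply, Fin.val_rev]
  split_ifs <;> first | omega | rfl

theorem Xmat_mul_Xmat {n k : ℕ} (hk : 1 ≤ k) (hkn : 2 * k ≤ n) (ε : ℝ) :
    Xmat n k ε * Xmat n k ε = 0 := by
  ext s t
  rw [Matrix.mul_apply, Matrix.zero_apply]
  refine Finset.sum_eq_zero fun b _ => ?_
  by_cases hb : (b : ℕ) < k
  · rw [Xmat_apply_of_row_lt (s := b) hk (by omega) ε (by omega), mul_zero]
  · rw [Xmat_apply_of_le hk (by omega) ε (not_lt.mp hb), zero_mul]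

theorem Xmat_mul_transpose_mul {n k : ℕ} (hk : 1 ≤ k) (hkn : k ≤ n) {ε : ℝ}
    (hε : ε = 1 ∨ ε = -1) :
    Xmat n k ε * (Xmat n k ε)ᵀ * Xmat n k ε = Xmat n k ε := by
  rw [Xmat_mul_transpose_Xmat hk hkn hε]
  ext s t
  rw [Matrix.diagonal_mul]
  split_ifs with h
  · rw [one_mul]
  · rw [Xmat_apply_of_row_lt hk hkn ε (not_le.mp h), zero_mul]

theorem transpose_Xmat_mul_transpose_Xmat {n k : ℕ} (hk : 1 ≤ k) (hkn : 2 * k ≤ n) (ε : ℝ) :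
    (Xmat n k ε)ᵀ * (Xmat n k ε)ᵀ = 0 := by
  rw [← Matrix.transpose_mul, Xmat_mul_Xmat hk hkn, Matrix.transpose_zero]

theorem transpose_Xmat_mul_Xmat_mul_transpose {n k : ℕ} (hk : 1 ≤ k) (hkn : k ≤ n) {ε : ℝ}
    (hε : ε = 1 ∨ ε = -1) :
    (Xmat n k ε)ᵀ * Xmat n k ε * (Xmat n k ε)ᵀ = (Xmat n k ε)ᵀ := by
  simpa only [Matrix.transpose_mul, Matrix.transpose_transpose, mul_assoc] using
    congrArg Matrix.transpose (Xmat_mul_transpose_mul hk hkn hε)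

/-- Up to sign, the determinant of the lower-left `k × k` block of `M`. -/
noncomputable def cornerDet (n k : ℕ) (ε : ℝ) (M : Matrix (Fin n) (Fin n) ℝ) : ℝ :=
  (1 + (Xmat n k ε)ᵀ * (M * (Xmat n k ε)ᵀ - 1) * Xmat n k ε).det

theorem continuous_cornerDet (n k : ℕ) (ε : ℝ) : Continuous (cornerDet n k ε) := by
  unfold cornerDet
  exact Continuous.matrix_det (by fun_prop)

theorem cornerDet_Xmat {n k : ℕ} (hk : 1 ≤ k) (hkn : k ≤ n) {ε : ℝ} (hε : ε = 1 ∨ ε = -1) :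
    cornerDet n k ε (Xmat n k ε) = 1 := by
  rw [cornerDet, mul_assoc, sub_mul, Xmat_mul_transpose_mul hk hkn hε, one_mul, sub_self,
    mul_zero, add_zero, Matrix.det_one]

theorem cornerDet_transpose_submatrix_rev {n k : ℕ} (hk : 1 ≤ k) (hkn : k ≤ n) (ε : ℝ)
    (M : Matrix (Fin n) (Fin n) ℝ) :
    cornerDet n k ε (Mᵀ.submatrix Fin.revPerm Fin.revPerm) = cornerDet n k ε M := by
  have hX := transpose_submatrix_rev_Xmat hk hkn ε
  have hX' := congrArg Matrix.transpose hX
  rw [Matrix.transpose_submatrix] at hX'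
  have hone : (1 : Matrix (Fin n) (Fin n) ℝ)ᵀ.submatrix Fin.revPerm Fin.revPerm = 1 := by
    rw [Matrix.transpose_one, Matrix.submatrix_one_equiv]
  have key : cornerDet n k ε (Mᵀ.submatrix Fin.revPerm Fin.revPerm) =
      (1 + Xmat n k ε * (((Xmat n k ε)ᵀ * M - 1) * (Xmat n k ε)ᵀ)).det := by
    rw [← Matrix.det_transpose, ← Matrix.det_submatrix_equiv_self Fin.revPerm,
      Matrix.transpose_add, Matrix.submatrix_add, Pi.add_apply, Pi.add_apply, hone, ← mul_assoc,
      transpose_mul_submatrix_rev, transpose_mul_submatrix_rev, Matrix.transpose_sub,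
      Matrix.submatrix_sub, Pi.sub_apply, Pi.sub_apply, hone, transpose_mul_submatrix_rev, hX, hX',
      cornerDet, mul_assoc]
  rw [key, Matrix.det_one_add_mul_comm, cornerDet]
  congr 1
  noncomm_ring

theorem exists_conj_of_cornerDet_ne_zero {n k : ℕ} (hk : 1 ≤ k) (hkn : 2 * k ≤ n) {ε : ℝ}
    (hε : ε = 1 ∨ ε = -1) {g g' : Matrix (Fin n) (Fin n) ℝ} (hg : g' * g = 1)
    (hdet : cornerDet n k ε (g * Xmat n k ε * g') ≠ 0) :
    ∃ p : Matrix (Fin n) (Fin n) ℝ, p.det ≠ 0 ∧ g * Xmat n k ε * g' * p = p * Xmat n k ε ∧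
      ∀ s t : Fin n, (t : ℕ) < n - k → t < s → p s t = 0 := by
  have hkn' : k ≤ n := by omega
  have hV := Matrix.nonsing_inv_mul _ (isUnit_iff_ne_zero.mpr hdet)
  obtain ⟨m, q, hq, hp⟩ := exists_conj_of_left_inverse (Xmat_mul_transpose_mul hk hkn' hε)
    (transpose_Xmat_mul_Xmat_mul_transpose hk hkn' hε) (Xmat_mul_Xmat hk hkn ε)
    (transpose_Xmat_mul_transpose_Xmat hk hkn ε) hg hV
  refine ⟨_, fun h => ?_, hp, fun s t ht hts => ?_⟩
  · have h' := congrArg Matrix.det hq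
    rw [Matrix.det_mul, h, mul_zero, Matrix.det_one] at h'
    exact zero_ne_one h'
  · have hG : (1 : Matrix (Fin n) (Fin n) ℝ) - Xmat n k ε * (Xmat n k ε)ᵀ -
        (Xmat n k ε)ᵀ * Xmat n k ε = Matrix.diagonal fun s : Fin n =>
          1 - (if n - k ≤ (s : ℕ) then (1 : ℝ) else 0) - (if (s : ℕ) < k then (1 : ℝ) else 0) := by
      rw [Xmat_mul_transpose_Xmat hk hkn' hε, transpose_Xmat_mul_Xmat hk hkn' hε,
        ← Matrix.diagonal_one, Matrix.diagonal_sub, Matrix.diagonal_sub]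
    have hzy : (g * Xmat n k ε * g' * (Xmat n k ε)ᵀ) s t = 0 := by
      rw [Matrix.mul_apply]
      refine Finset.sum_eq_zero fun b _ => ?_
      rw [Matrix.transpose_apply, Xmat_apply_of_row_lt hk hkn' ε ht, mul_zero]
    rw [hG, Matrix.sub_apply, Matrix.add_apply, hzy, Matrix.mul_diagonal,
      transpose_Xmat_mul_Xmat hk hkn' hε, Matrix.diagonal_mul, Matrix.sub_apply,
      Matrix.one_apply_ne hts.ne', Xmat_mul_transpose_Xmat hk hkn' hε,
      Matrix.diagonal_apply_ne _ hts.ne']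
    rw [Fin.lt_def] at hts
    split_ifs <;> first | omega | simp

theorem det_nonneg_of_commute {n : ℕ} {x y q : Matrix (Fin n) (Fin n) ℝ} (hxx : x * x = 0)
    (hyy : y * y = 0) (hxy : x * y + y * x = 1) (hq : q * x = x * q) : 0 ≤ q.det := by
  have hxyx : x * (y * x) = x := by
    have := congrArg (x * ·) hxy
    simpa only [mul_add, ← mul_assoc, hxx, zero_mul, zero_add, mul_one] using this
  have hyxy : y * (x * y) = y := by
    have := congrArg (y * ·) hxy
    simpa only [mul_add, ← mul_assoc, hyy, zero_mul, add_zero, mul_one] using this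
  have hxyx' (r) : x * (y * (x * r)) = x * r := by rw [← mul_assoc y, ← mul_assoc, hxyx]
  have hyxy' (r) : y * (x * (y * r)) = y * r := by rw [← mul_assoc x, ← mul_assoc, hyxy]
  have hxx' (r) : x * (x * r) = 0 := by rw [← mul_assoc, hxx, zero_mul]
  have hyy' (r) : y * (y * r) = 0 := by rw [← mul_assoc, hyy, zero_mul]
  have hq' (r) : q * (x * r) = x * (q * r) := by rw [← mul_assoc, hq, mul_assoc]
  set a := y * x * q * (y * x) + x * y with ha
  set c := (1 / 2 : ℝ) • (x * y * q * (y * x)) with hc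
  have hdiag : (x + y) * a * (x + y) = x * y * q * (x * y) + y * x := by
    simp only [ha, mul_add, add_mul, mul_assoc, hxyx', hyxy, hxx, hxx', hyy, hyy', hq',
      mul_zero, zero_mul]
    abel
  have hcc : (1 + c) * (1 + c) = 1 + x * y * q * (y * x) := by
    have h0 : c * c = 0 := by
      simp only [hc, Matrix.smul_mul, Matrix.mul_smul, mul_assoc, hxx', mul_zero, smul_zero]
    have h1 : c + c = x * y * q * (y * x) := by rw [hc, ← add_smul]; norm_num
    rw [mul_add, mul_one, add_mul, one_mul, h0, add_zero, add_assoc, h1]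
  have hfac : q = a * ((1 + c) * (1 + c)) * ((x + y) * a * (x + y)) := by
    have hsplit : q = (x * y + y * x) * q * (x * y + y * x) := by rw [hxy, one_mul, mul_one]
    rw [hdiag, hcc]
    conv_lhs => rw [hsplit]
    simp only [ha, mul_add, add_mul, mul_assoc, hxyx, hxyx', hyxy', hxx', hyy', hq',
      mul_zero, zero_mul, mul_one]
    abel
  rw [hfac]
  simp only [Matrix.det_mul]
  have : a.det * ((1 + c).det * (1 + c).det) * ((x + y).det * a.det * (x + y).det) =
      (a.det * (1 + c).det * (x + y).det) ^ 2 := by ring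
  rw [this]
  exact sq_nonneg _

theorem SpecialLinearGroup_conj_eq_iff {n : ℕ} (g : Matrix.SpecialLinearGroup (Fin n) ℝ)
    (A B : Matrix (Fin n) (Fin n) ℝ) : g.val * A * (g⁻¹).val = B ↔ B * g.val = g.val * A := by
  have h1 : (g⁻¹).val * g.val = 1 := by
    rw [← Matrix.SpecialLinearGroup.coe_mul, inv_mul_cancel, Matrix.SpecialLinearGroup.coe_one]
  have h2 : g.val * (g⁻¹).val = 1 := by
    rw [← Matrix.SpecialLinearGroup.coe_mul, mul_inv_cancel, Matrix.SpecialLinearGroup.coe_one]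
  constructor
  · rintro rfl
    rw [mul_assoc, h1, mul_one]
  · intro h
    rw [← h, mul_assoc, h2, mul_one]

theorem mem_Orb_iff {n k : ℕ} {ε : ℝ} {M : Matrix (Fin n) (Fin n) ℝ} :
    M ∈ Orb n k ε ↔
      ∃ g : Matrix.SpecialLinearGroup (Fin n) ℝ, M * g.val = g.val * Xmat n k ε := by
  simp only [Orb, Set.mem_ofPred_eq, SpecialLinearGroup_conj_eq_iff]

theorem mem_POrb_iff {n i k : ℕ} {ε : ℝ} {M : Matrix (Fin n) (Fin n) ℝ} :
    M ∈ POrb n i k ε ↔ ∃ p : Matrix.SpecialLinearGroup (Fin n) ℝ,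
      memP n i p ∧ M * p.val = p.val * Xmat n k ε := by
  simp only [POrb, Set.mem_ofPred_eq, SpecialLinearGroup_conj_eq_iff]

theorem exists_specialLinearGroup_eq_smul {n : ℕ} (hn : n ≠ 0) {h : Matrix (Fin n) (Fin n) ℝ}
    (hh : 0 < h.det) :
    ∃ (g : Matrix.SpecialLinearGroup (Fin n) ℝ) (c : ℝ), g.val = c • h := by
  refine ⟨⟨(h.det⁻¹ ^ ((n : ℝ)⁻¹)) • h, ?_⟩, _, rfl⟩
  rw [Matrix.det_smul, Fintype.card_fin, Real.rpow_inv_natCast_pow (inv_nonneg.mpr hh.le) hn,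
    inv_mul_cancel₀ hh.ne']

theorem memP_mul {n i : ℕ} {p q : Matrix.SpecialLinearGroup (Fin n) ℝ} (hp : memP n i p)
    (hq : memP n i q) : memP n i (p * q) := by
  intro s t hs ht
  rw [Matrix.SpecialLinearGroup.coe_mul, Matrix.mul_apply]
  refine Finset.sum_eq_zero fun b _ => ?_
  by_cases hb : (b : ℕ) < i
  · rw [hp s b hs hb, zero_mul]
  · rw [hq b t (not_lt.mp hb) ht, mul_zero]

theorem exists_memP_of_det_ne_zero {n k : ℕ} (hk : 1 ≤ k) (hkn : 2 * k ≤ n) {ε : ℝ}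
    (hε : ε = 1 ∨ ε = -1) {i : ℕ} {M p : Matrix (Fin n) (Fin n) ℝ} (hM : M ∈ Orb n k ε)
    (hdet : p.det ≠ 0) (hp : M * p = p * Xmat n k ε)
    (hpi : ∀ s t : Fin n, i ≤ (s : ℕ) → (t : ℕ) < i → p s t = 0) : M ∈ POrb n i k ε := by
  have of_pos {p : Matrix (Fin n) (Fin n) ℝ} (hdet : 0 < p.det) (hp : M * p = p * Xmat n k ε)
      (hpi : ∀ s t : Fin n, i ≤ (s : ℕ) → (t : ℕ) < i → p s t = 0) : M ∈ POrb n i k ε := by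
    obtain ⟨g, c, hg⟩ := exists_specialLinearGroup_eq_smul (by omega) hdet
    refine mem_POrb_iff.mpr ⟨g, fun s t hs ht => ?_, ?_⟩
    · rw [hg, Matrix.smul_apply, hpi s t hs ht, smul_zero]
    · rw [hg, Matrix.mul_smul, hp, Matrix.smul_mul]
  rcases hdet.lt_or_gt with hneg | hpos
  · rcases hkn.eq_or_lt with heq | hlt
    · obtain ⟨g, hg⟩ := mem_Orb_iff.mp hM
      have hinv : (g⁻¹).val * g.val = 1 := by
        rw [← Matrix.SpecialLinearGroup.coe_mul, inv_mul_cancel,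
          Matrix.SpecialLinearGroup.coe_one]
      have hX : Xmat n k ε = (g⁻¹).val * M * g.val := by
        rw [mul_assoc, hg, ← mul_assoc, hinv, one_mul]
      have hgg : g.val * (g⁻¹).val = 1 := mul_eq_one_comm.mp hinv
      have hcomm : (g⁻¹).val * p * Xmat n k ε = Xmat n k ε * ((g⁻¹).val * p) := by
        rw [mul_assoc, ← hp, hX]
        simp only [mul_assoc]
        rw [← mul_assoc g.val, hgg, one_mul]
      have hone : Xmat n k ε * (Xmat n k ε)ᵀ + (Xmat n k ε)ᵀ * Xmat n k ε = 1 := by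
        rw [Xmat_mul_transpose_Xmat hk (by omega) hε, transpose_Xmat_mul_Xmat hk (by omega) hε,
          Matrix.diagonal_add, ← Matrix.diagonal_one]
        congr 1
        ext s
        split_ifs <;> first | omega | simp
      have h := det_nonneg_of_commute (Xmat_mul_Xmat hk hkn ε)
        (transpose_Xmat_mul_transpose_Xmat hk hkn ε) hone hcomm
      rw [Matrix.det_mul, (g⁻¹).prop, one_mul] at h
      exact absurd hneg h.not_gt
    · let d : Fin n → ℝ := Function.update 1 ⟨k, by omega⟩ (-1)
      have hd {s : Fin n} (hs : (s : ℕ) ≠ k) : d s = 1 :=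
        Function.update_of_ne (fun h => hs (congrArg Fin.val h)) _ _
      refine of_pos (p := p * Matrix.diagonal d) ?_ ?_ fun s t hs ht => ?_
      · rw [Matrix.det_mul, Matrix.det_diagonal, Finset.prod_update_of_mem (Finset.mem_univ _)]
        simpa using hneg
      · rw [← mul_assoc, hp, mul_assoc, mul_assoc]
        congr 1
        ext s t
        rw [Matrix.mul_diagonal, Matrix.diagonal_mul]
        by_cases ht : (t : ℕ) < k
        · by_cases hs : (s : ℕ) = k
          · rw [Xmat_apply_of_add_ne hk (by omega) ε (by omega), zero_mul, mul_zero]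
          · rw [hd hs, hd ht.ne, one_mul, mul_one]
        · rw [Xmat_apply_of_le hk (by omega) ε (not_lt.mp ht), zero_mul, mul_zero]
      · rw [Matrix.mul_diagonal, hpi s t hs ht, zero_mul]
  · exact of_pos hpos hp hpi

theorem nonsing_inv_apply_eq_zero {n i : ℕ} {p : Matrix (Fin n) (Fin n) ℝ} (hdet : p.det ≠ 0)
    (hpi : ∀ s t : Fin n, i ≤ (s : ℕ) → (t : ℕ) < i → p s t = 0) (s t : Fin n)
    (hs : i ≤ (s : ℕ)) (ht : (t : ℕ) < i) : p⁻¹ s t = 0 := by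
  let b : Fin n → ℕ := fun s => if i ≤ (s : ℕ) then 1 else 0
  have hb : p.BlockTriangular b := fun s t hst => by
    refine hpi s t ?_ ?_ <;> by_contra h <;> simp only [b] at hst <;> split_ifs at hst <;> omega
  have := Matrix.invertibleOfIsUnitDet p (isUnit_iff_ne_zero.mpr hdet)
  refine Matrix.blockTriangular_inv_of_blockTriangular hb ?_
  simp only [b]
  rw [if_pos hs, if_neg (not_le.mpr ht)]
  exact zero_lt_one

theorem memP_inv {n i : ℕ} {p : Matrix.SpecialLinearGroup (Fin n) ℝ} (hp : memP n i p) :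
    memP n i p⁻¹ := by
  have hinv : (p⁻¹).val = p.val⁻¹ := by
    rw [Matrix.SpecialLinearGroup.coe_inv, Matrix.inv_def, p.prop, Ring.inverse_one, one_smul]
  have hdet : p.val.det ≠ 0 := by rw [p.prop]; exact one_ne_zero
  intro s t hs ht
  rw [hinv, nonsing_inv_apply_eq_zero hdet hp s t hs ht]

theorem mem_POrb_of_cornerDet_ne_zero {n k : ℕ} (hk : 1 ≤ k) (hkn : 2 * k ≤ n) {ε : ℝ}
    (hε : ε = 1 ∨ ε = -1) (i : ℕ) {M : Matrix (Fin n) (Fin n) ℝ} (hM : M ∈ Orb n k ε)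
    (hdet : cornerDet n k ε M ≠ 0) : M ∈ POrb n i k ε := by
  have hkn' : k ≤ n := by omega
  obtain ⟨g, hg⟩ := id hM
  have hinv : (g⁻¹).val * g.val = 1 := by
    rw [← Matrix.SpecialLinearGroup.coe_mul, inv_mul_cancel, Matrix.SpecialLinearGroup.coe_one]
  rcases le_or_gt i (n - k) with hi | hi
  · obtain ⟨p, hp, hMp, hps⟩ := exists_conj_of_cornerDet_ne_zero hk hkn hε hinv (hg ▸ hdet)
    rw [hg] at hMp
    exact exists_memP_of_det_ne_zero hk hkn hε hM hp hMp
      fun s t hs ht => hps s t (by omega) (Fin.lt_def.mpr (by omega))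
  · have hτ := congrArg (fun A : Matrix (Fin n) (Fin n) ℝ =>
      Aᵀ.submatrix Fin.revPerm Fin.revPerm) hg
    simp only [transpose_mul_submatrix_rev, transpose_submatrix_rev_Xmat hk hkn'] at hτ
    rw [← mul_assoc] at hτ
    have hinv' := congrArg (fun A : Matrix (Fin n) (Fin n) ℝ =>
      Aᵀ.submatrix Fin.revPerm Fin.revPerm) hinv
    simp only [transpose_mul_submatrix_rev, Matrix.transpose_one,
      Matrix.submatrix_one_equiv] at hinv'
    rw [← cornerDet_transpose_submatrix_rev hk hkn', ← hτ] at hdet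
    obtain ⟨p, hp, hMp, hps⟩ := exists_conj_of_cornerDet_ne_zero hk hkn hε hinv' hdet
    rw [hτ] at hMp
    have hMp' := congrArg (fun A : Matrix (Fin n) (Fin n) ℝ =>
      Aᵀ.submatrix Fin.revPerm Fin.revPerm) hMp
    simp only [transpose_mul_submatrix_rev, transpose_submatrix_rev_Xmat hk hkn',
      Matrix.transpose_submatrix, Matrix.transpose_transpose, Matrix.submatrix_submatrix] at hMp'
    have hrev : (Fin.revPerm : Fin n → Fin n) ∘ Fin.revPerm = id := by
      ext; simp
    rw [hrev, Matrix.submatrix_id_id] at hMp'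
    have hdet' : (pᵀ.submatrix Fin.revPerm Fin.revPerm).det ≠ 0 := by
      rwa [Matrix.det_submatrix_equiv_self, Matrix.det_transpose]
    have hu := isUnit_iff_ne_zero.mpr hdet'
    refine exists_memP_of_det_ne_zero hk hkn hε hM (Matrix.isUnit_nonsing_inv_det _ hu).ne_zero ?_
      (nonsing_inv_apply_eq_zero hdet' fun s t hs ht => ?_)
    · generalize pᵀ.submatrix Fin.revPerm Fin.revPerm = h at hMp' hu
      calc M * h⁻¹ = h⁻¹ * (h * M) * h⁻¹ := by
            rw [← mul_assoc, Matrix.nonsing_inv_mul _ hu, one_mul]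
        _ = h⁻¹ * Xmat n k ε := by
            rw [hMp', mul_assoc, mul_assoc, Matrix.mul_nonsing_inv _ hu, mul_one]
    · have hsn := s.isLt
      simp only [Matrix.submatrix_apply, Matrix.transpose_apply, Fin.revPerm_apply]
      refine hps _ _ ?_ (Fin.rev_lt_rev.mpr (Fin.lt_def.mpr (by omega)))
      rw [Fin.val_rev]
      omega

theorem exists_polynomial_eval_eq {n : ℕ} (g x y : Matrix (Fin n) (Fin n) ℝ) :
    ∃ P : Polynomial ℝ, ∀ t : ℝ, P.eval t =
      (let h := (1 - t) • g + t • 1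
       h * h.adjugate * (1 - y * x) + y * h * x * h.adjugate * y * x).det := by
  let C : Matrix (Fin n) (Fin n) ℝ →+* Matrix (Fin n) (Fin n) (Polynomial ℝ) :=
    Polynomial.C.mapMatrix
  let H := Matrix.scalar (Fin n) (1 - Polynomial.X) * C g + Matrix.scalar (Fin n) Polynomial.X
  refine ⟨(H * H.adjugate * (1 - C y * C x) + C y * H * C x * H.adjugate * C y * C x).det,
    fun t => ?_⟩
  let e : Matrix (Fin n) (Fin n) (Polynomial ℝ) →+* Matrix (Fin n) (Fin n) ℝ :=
    (Polynomial.evalRingHom t).mapMatrix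
  have hC (A) : e (C A) = A := by
    ext; simp [e, C]
  have hH : e H = (1 - t) • g + t • 1 := by
    have hs (a : Polynomial ℝ) : e (Matrix.scalar (Fin n) a) = a.eval t • 1 := by
      ext r s
      by_cases hrs : r = s
      · subst hrs; simp [e]
      · simp [e, hrs]
    simp only [H, map_add, map_mul, hs, hC]
    simp
  have hadj : e H.adjugate = (e H).adjugate := RingHom.map_adjugate _ _
  rw [← Polynomial.coe_evalRingHom, RingHom.map_det]
  change (e _).det = _
  simp only [map_add, map_mul, map_sub, map_one, hC, hadj, hH]

theorem mem_closure_POrb {n k : ℕ} (hk : 1 ≤ k) (hkn : 2 * k ≤ n) {ε : ℝ}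
    (hε : ε = 1 ∨ ε = -1) (i : ℕ) {M : Matrix (Fin n) (Fin n) ℝ} (hM : M ∈ Orb n k ε) :
    M ∈ closure (POrb n i k ε) := by
  have hkn' : k ≤ n := by omega
  obtain ⟨g, hg⟩ := mem_Orb_iff.mp hM
  set x := Xmat n k ε
  obtain ⟨P, hP⟩ := exists_polynomial_eval_eq g.val x xᵀ
  let h : ℝ → Matrix (Fin n) (Fin n) ℝ := fun t => (1 - t) • g.val + t • 1
  have hcont : Continuous h := by fun_prop
  have h0 : h 0 = g.val := by simp [h]
  have hP1 : P.eval 1 = 1 := by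
    have hyxy : xᵀ * x * xᵀ = xᵀ := transpose_Xmat_mul_Xmat_mul_transpose hk hkn' hε
    rw [hP]
    simp [hyxy]
  have hPne : ∀ᶠ t in nhdsWithin (0 : ℝ) {0}ᶜ, P.eval t ≠ 0 := by
    have hfin : {t | P.eval t = 0}.Finite := by
      refine Polynomial.finite_setOfPred_isRoot fun h => ?_
      simp [h] at hP1
    have hclosed := (hfin.subset (Set.sdiff_subset (t := {0}))).isClosed
    have : ({t | P.eval t = 0} \ {0})ᶜ ∈ nhds (0 : ℝ) := hclosed.isOpen_compl.mem_nhds (by simp)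
    filter_upwards [nhdsWithin_le_nhds this, self_mem_nhdsWithin] with t ht ht0 hPt
    exact ht ⟨hPt, ht0⟩
  have hdetcont : Continuous fun t => (h t).det := hcont.matrix_det
  have hpos : ∀ᶠ t in nhds (0 : ℝ), 0 < (h t).det :=
    hdetcont.continuousAt.eventually (lt_mem_nhds (by simp only [h0, g.prop, zero_lt_one]))
  have hlim : Filter.Tendsto (fun t => (h t).det⁻¹ • (h t * x * (h t).adjugate))
      (nhds 0) (nhds M) := by
    have hval : (h 0).det⁻¹ • (h 0 * x * (h 0).adjugate) = M := by
      rw [h0, g.prop, inv_one, one_smul, ← hg, mul_assoc, Matrix.mul_adjugate, g.prop, one_smul,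
        mul_one]
    rw [← hval]
    refine ContinuousAt.smul (hdetcont.continuousAt.inv₀ ?_) ?_
    · rw [h0, g.prop]; exact one_ne_zero
    · exact ((hcont.mul continuous_const).mul hcont.matrix_adjugate).continuousAt
  refine mem_closure_of_tendsto (hlim.mono_left (nhdsWithin_le_nhds (s := {0}ᶜ))) ?_
  filter_upwards [hPne, nhdsWithin_le_nhds hpos] with t hPt ht
  refine mem_POrb_of_cornerDet_ne_zero hk hkn hε i ?_ fun hdet => hPt ?_
  · obtain ⟨g', c, hg'⟩ := exists_specialLinearGroup_eq_smul (by omega) ht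
    refine mem_Orb_iff.mpr ⟨g', ?_⟩
    rw [hg', Matrix.mul_smul, Matrix.smul_mul, mul_assoc (h t * x), Matrix.adjugate_mul,
      Matrix.mul_smul, mul_one, inv_smul_smul₀ ht.ne', Matrix.smul_mul]
  · have hscale : h t * (h t).adjugate * (1 - xᵀ * x) + xᵀ * h t * x * (h t).adjugate * xᵀ * x =
        (h t).det • (1 + xᵀ * ((h t).det⁻¹ • (h t * x * (h t).adjugate) * xᵀ - 1) * x) := by
      simp only [Matrix.mul_adjugate, mul_sub, sub_mul, Matrix.smul_mul, Matrix.mul_smul, mul_one,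
        one_mul, smul_add, smul_sub, smul_inv_smul₀ ht.ne', mul_assoc]
      abel
    rw [hP]
    change (h t * (h t).adjugate * (1 - xᵀ * x) + xᵀ * h t * x * (h t).adjugate * xᵀ * x).det = 0
    rw [hscale, Matrix.det_smul]
    exact mul_eq_zero_of_right _ hdet

theorem isOpen_POrb_in_Orb {n k : ℕ} (hk : 1 ≤ k) (hkn : 2 * k ≤ n) {ε : ℝ}
    (hε : ε = 1 ∨ ε = -1) (i : ℕ) :
    IsOpen {x : ↥(Orb n k ε) | (x : Matrix (Fin n) (Fin n) ℝ) ∈ POrb n i k ε} := by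
  have hset : {x : ↥(Orb n k ε) | (x : Matrix (Fin n) (Fin n) ℝ) ∈ POrb n i k ε} =
      ⋃ (p : Matrix.SpecialLinearGroup (Fin n) ℝ) (_ : memP n i p),
        {x : ↥(Orb n k ε) | cornerDet n k ε ((p⁻¹).val * x.val * p.val) ≠ 0} := by
    ext ⟨M, hM⟩
    simp only [Set.mem_ofPred_eq, Set.mem_iUnion, exists_prop]
    constructor
    · intro h
      obtain ⟨p, hp, hMp⟩ := mem_POrb_iff.mp h
      refine ⟨p, hp, ?_⟩
      rw [mul_assoc, hMp, ← mul_assoc, ← Matrix.SpecialLinearGroup.coe_mul, inv_mul_cancel,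
        Matrix.SpecialLinearGroup.coe_one, one_mul, cornerDet_Xmat hk (by omega) hε]
      exact one_ne_zero
    · rintro ⟨p, hp, hdet⟩
      obtain ⟨g, hg⟩ := mem_Orb_iff.mp hM
      have hconj : p.val * ((p⁻¹).val * M * p.val) = M * p.val := by
        rw [← mul_assoc, ← mul_assoc, ← Matrix.SpecialLinearGroup.coe_mul, mul_inv_cancel,
          Matrix.SpecialLinearGroup.coe_one, one_mul]
      have hmem : (p⁻¹).val * M * p.val ∈ Orb n k ε := by
        refine mem_Orb_iff.mpr ⟨p⁻¹ * g, ?_⟩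
        rw [Matrix.SpecialLinearGroup.coe_mul, mul_assoc _ _ (Xmat n k ε), ← hg, ← mul_assoc,
          mul_assoc _ p.val, ← Matrix.SpecialLinearGroup.coe_mul, mul_inv_cancel,
          Matrix.SpecialLinearGroup.coe_one, mul_one, mul_assoc]
      obtain ⟨r, hr, hMr⟩ := mem_POrb_iff.mp (mem_POrb_of_cornerDet_ne_zero hk hkn hε i hmem hdet)
      refine mem_POrb_iff.mpr ⟨p * r, memP_mul hp hr, ?_⟩
      rw [Matrix.SpecialLinearGroup.coe_mul, ← mul_assoc, ← hconj, mul_assoc, hMr, mul_assoc]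
  rw [hset]
  refine isOpen_biUnion fun p _ => ?_
  exact isOpen_ne.preimage ((continuous_cornerDet n k ε).comp (by fun_prop))

theorem POrbit_open_dense_unique (n : ℕ) (hn : 4 ≤ n) (k : ℕ) (hk : 2 ≤ k)
    (hkn : 2 * k ≤ n) (ε : ℝ) (hε : ε = 1 ∨ ε = -1)
    (i : ℕ) (hi1 : 1 ≤ i) (hi2 : i ≤ n - 1) :
    IsOpen {x : ↥(Orb n k ε) | (x : Matrix (Fin n) (Fin n) ℝ) ∈ POrb n i k ε} ∧
    (∀ M ∈ Orb n k ε, M ∈ closure (POrb n i k ε)) ∧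
    (∀ Z ∈ Orb n k ε,
      (∀ M ∈ Orb n k ε, M ∈ closure {W | ∃ p : Matrix.SpecialLinearGroup (Fin n) ℝ,
          memP n i p ∧ p.val * Z * (p⁻¹).val = W}) →
      ∃ p : Matrix.SpecialLinearGroup (Fin n) ℝ, memP n i p ∧
        Z = p.val * Xmat n k ε * (p⁻¹).val) := by
  have hk' : 1 ≤ k := by omega
  have hopen := isOpen_POrb_in_Orb hk' hkn hε i
  refine ⟨hopen, fun M hM => mem_closure_POrb hk' hkn hε i hM, fun Z hZ hdense => ?_⟩
  have hX : Xmat n k ε ∈ Orb n k ε := mem_Orb_iff.mpr ⟨1, by simp⟩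
  have hXP : Xmat n k ε ∈ POrb n i k ε := by
    refine mem_POrb_iff.mpr ⟨1, fun s t hs ht => ?_, by simp⟩
    rw [Matrix.SpecialLinearGroup.coe_one, Matrix.one_apply_ne]
    rintro rfl
    omega
  obtain ⟨U, hU, hUP⟩ := isOpen_induced_iff.mp hopen
  have hUiff (M) (hM : M ∈ Orb n k ε) : M ∈ U ↔ M ∈ POrb n i k ε :=
    Set.ext_iff.mp hUP ⟨M, hM⟩
  obtain ⟨W, hWU, p, hp, hW⟩ := mem_closure_iff.mp (hdense _ hX) U hU ((hUiff _ hX).mpr hXP)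
  have hZp := (SpecialLinearGroup_conj_eq_iff p Z W).mp hW
  obtain ⟨g, hg⟩ := mem_Orb_iff.mp hZ
  have hWO : W ∈ Orb n k ε := by
    refine mem_Orb_iff.mpr ⟨p * g, ?_⟩
    rw [Matrix.SpecialLinearGroup.coe_mul, ← mul_assoc, hZp, mul_assoc, hg, mul_assoc]
  obtain ⟨r, hr, hWr⟩ := mem_POrb_iff.mp ((hUiff W hWO).mp hWU)
  refine ⟨p⁻¹ * r, memP_mul (memP_inv hp) hr, ?_⟩
  symm
  rw [SpecialLinearGroup_conj_eq_iff, Matrix.SpecialLinearGroup.coe_mul, mul_assoc, ← hWr, ← hW]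
  simp only [← mul_assoc]
  rw [← Matrix.SpecialLinearGroup.coe_mul p⁻¹ p, inv_mul_cancel, Matrix.SpecialLinearGroup.coe_one,
    one_mul]
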